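/- Let η₂ > 0 and for 0 < α < η₂ set m_α = α/η₂ and F(α) = (α² + η₂²)/2 + α²(α² − η₂²)/(α² − η₂² + η₂²·E(m_α)/K(m_α)). Then F(α) → η₂² as α → η₂⁻. -/

import Mathlib

open MeasureTheory intervalIntegral Filter

/-- The complete elliptic integral of the first kind. -/
noncomputable def ellipticK (m : ℝ) : ℝ :=
  ∫ θ in (0:ℝ)..(Real.pi / 2), 1 / Real.sqrt (1 - m ^ 2 * Real.sin θ ^ 2)

/-- The complete elliptic integral of the second kind. -/
noncomputable def ellipticE (m : ℝ) : ℝ :=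
  ∫ θ in (0:ℝ)..(Real.pi / 2), Real.sqrt (1 - m ^ 2 * Real.sin θ ^ 2)

lemma aux_pos (m : ℝ) (h0 : 0 < m) (h1 : m < 1) (θ : ℝ) :
    1 - m ^ 2 ≤ 1 - m ^ 2 * Real.sin θ ^ 2 ∧ 0 < 1 - m ^ 2 := by
  have := Real.sin_sq_le_one θ
  constructor <;> nlinarith [sq_nonneg m]

lemma aux_cont (m : ℝ) (h0 : 0 < m) (h1 : m < 1) :
    Continuous fun θ : ℝ => 1 / Real.sqrt (1 - m ^ 2 * Real.sin θ ^ 2) := by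
  refine Continuous.div continuous_const (by fun_prop) fun θ => ?_
  have := aux_pos m h0 h1 θ
  exact (Real.sqrt_pos.2 (by linarith)).ne'

lemma aux_K_pos (m : ℝ) (h0 : 0 < m) (h1 : m < 1) : 0 < ellipticK m := by
  unfold ellipticK
  refine intervalIntegral_pos_of_pos ((aux_cont m h0 h1).intervalIntegrable _ _) (fun θ => ?_)
    (by positivity)
  have := aux_pos m h0 h1 θ
  have := Real.sqrt_pos.2 (show 0 < 1 - m ^ 2 * Real.sin θ ^ 2 by linarith)
  positivity

lemma aux_K_le (m : ℝ) (h0 : 0 < m) (h1 : m < 1) :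
    (1 - m ^ 2) * ellipticK m ≤ Real.pi / 2 * Real.sqrt (1 - m ^ 2) := by
  have hc := (aux_pos m h0 h1 0).2
  have hs := Real.sqrt_pos.2 hc
  have h : ellipticK m ≤ ∫ θ in (0:ℝ)..(Real.pi / 2), 1 / Real.sqrt (1 - m ^ 2) := by
    unfold ellipticK
    refine integral_mono_on (by positivity) ((aux_cont m h0 h1).intervalIntegrable _ _)
      (by simp) fun θ _ => ?_
    exact one_div_le_one_div_of_le hs (Real.sqrt_le_sqrt (aux_pos m h0 h1 θ).1)
  rw [intervalIntegral.integral_const, smul_eq_mul, sub_zero] at h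
  calc (1 - m ^ 2) * ellipticK m
      ≤ (1 - m ^ 2) * (Real.pi / 2 * (1 / Real.sqrt (1 - m ^ 2))) := by gcongr
    _ = (Real.sqrt (1 - m ^ 2)) ^ 2 * (Real.pi / 2 * (1 / Real.sqrt (1 - m ^ 2))) := by
        rw [Real.sq_sqrt hc.le]
    _ = _ := by field_simp

lemma aux_E_ge (m : ℝ) (h0 : 0 < m) (h1 : m < 1) : 1 ≤ ellipticE m := by
  have h : ∫ θ in (0:ℝ)..(Real.pi / 2), Real.cos θ = 1 := by simp
  rw [← h]
  unfold ellipticE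
  refine integral_mono_on (by positivity) (Real.continuous_cos.intervalIntegrable _ _)
    (Continuous.intervalIntegrable (by fun_prop) _ _) fun θ _ => ?_
  apply Real.le_sqrt_of_sq_le
  rw [Real.cos_sq']
  nlinarith [mul_nonneg (sq_nonneg (Real.sin θ)) (aux_pos m h0 h1 0).2.le]

/-- the Whitham modulation velocity F(α) tends to η₂²
as α → η₂⁻. -/
theorem whitham_velocity_leading_edge (η₂ : ℝ) (hη₂ : 0 < η₂)
    (F : ℝ → ℝ)
    (hF : ∀ α : ℝ, F α = (α ^ 2 + η₂ ^ 2) / 2 +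
      α ^ 2 * (α ^ 2 - η₂ ^ 2) /
        (α ^ 2 - η₂ ^ 2 + η₂ ^ 2 * (ellipticE (α / η₂) / ellipticK (α / η₂)))) :
    Tendsto F (nhdsWithin η₂ (Set.Iio η₂)) (nhds (η₂ ^ 2)) := by
  set b : ℝ → ℝ := fun α => Real.pi / 2 * Real.sqrt (1 - (α / η₂) ^ 2) with hb
  have hbc : Continuous b := by fun_prop
  have hb0 : b η₂ = 0 := by simp [hb, hη₂.ne']
  have hbt : Tendsto b (nhdsWithin η₂ (Set.Iio η₂)) (nhds 0) := by
    have := hbc.tendsto η₂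
    rw [hb0] at this
    exact this.mono_left nhdsWithin_le_nhds
  have hα : Tendsto (fun α : ℝ => α) (nhdsWithin η₂ (Set.Iio η₂)) (nhds η₂) :=
    tendsto_id.mono_left nhdsWithin_le_nhds
  have hup : Tendsto (fun α => (α ^ 2 + η₂ ^ 2) / 2) (nhdsWithin η₂ (Set.Iio η₂))
      (nhds (η₂ ^ 2)) := by
    have := ((hα.pow 2).add_const (η₂ ^ 2)).div_const 2
    simpa using this
  have hlow : Tendsto (fun α => (α ^ 2 + η₂ ^ 2) / 2 - α ^ 2 * (b α / (1 - b α)))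
      (nhdsWithin η₂ (Set.Iio η₂)) (nhds (η₂ ^ 2)) := by
    have h1 : Tendsto (fun α => b α / (1 - b α)) (nhdsWithin η₂ (Set.Iio η₂)) (nhds 0) := by
      have := hbt.div (hbt.const_sub 1) (by norm_num)
      simpa [Pi.div_def] using this
    have := hup.sub ((hα.pow 2).mul h1)
    simpa using this
  have key : ∀ᶠ α in nhdsWithin η₂ (Set.Iio η₂),
      (α ^ 2 + η₂ ^ 2) / 2 - α ^ 2 * (b α / (1 - b α)) ≤ F α ∧ F α ≤ (α ^ 2 + η₂ ^ 2) / 2 := by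
    filter_upwards [hbt.eventually (gt_mem_nhds one_pos), hα.eventually (lt_mem_nhds hη₂),
      self_mem_nhdsWithin] with α hb1 h0 hlt
    have hm0 : 0 < α / η₂ := by positivity
    have hm1 : α / η₂ < 1 := (div_lt_one hη₂).2 hlt
    have hK := aux_K_pos _ hm0 hm1
    have hKle := aux_K_le _ hm0 hm1
    have hE := aux_E_ge _ hm0 hm1
    have hc := (aux_pos _ hm0 hm1 0).2
    rw [hF]
    change _ ≤ b α at hKle
    set K := ellipticK (α / η₂)
    set E := ellipticE (α / η₂)
    obtain ⟨m, hm⟩ : ∃ m, m = α / η₂ := ⟨_, rfl⟩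
    rw [← hm] at hKle hc
    have ham : α = m * η₂ := by rw [hm]; field_simp
    set x := (1 - m ^ 2) * K with hx
    have hx0 : 0 < x := by positivity
    have hEx : 0 < E - x := by linarith
    have hden : α ^ 2 - η₂ ^ 2 + η₂ ^ 2 * (E / K) = η₂ ^ 2 * (E - x) / K := by
      rw [ham, hx]; field_simp; ring
    have hnum : α ^ 2 - η₂ ^ 2 = - (η₂ ^ 2 * x / K) := by
      rw [ham, hx]; field_simp; ring
    have heq : α ^ 2 * (α ^ 2 - η₂ ^ 2) / (α ^ 2 - η₂ ^ 2 + η₂ ^ 2 * (E / K))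
        = - (α ^ 2 * (x / (E - x))) := by
      rw [hden, hnum]; field_simp
    rw [heq]
    have hle : x / (E - x) ≤ b α / (1 - b α) :=
      div_le_div₀ (by linarith) hKle (by linarith) (by linarith)
    have h2 : α ^ 2 * (x / (E - x)) ≤ α ^ 2 * (b α / (1 - b α)) := by gcongr
    have h3 : 0 ≤ α ^ 2 * (x / (E - x)) := by positivity
    constructor <;> linarith
  exact tendsto_of_tendsto_of_tendsto_of_le_of_le' hlow hup
    (key.mono fun _ h => h.1) (key.mono fun _ h => h.2)
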